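/- Let V : ℤ → ℝ be periodic with period p ≥ 1 and let H be the Schrödinger operator on ℓ²(ℤ) with potential V. Then E ∈ σ(H) if and only if there exist k ∈ ℝ and a not identically vanishing function u : ℤ → ℂ satisfying u(n+1) + u(n−1) + V(n)u(n) = E u(n) and u(n+p) = e^{ikp} u(n) for all n ∈ ℤ. -/

import Mathlib

/-- The one-step transfer matrix of the recursion `u (n + 1) = a * u n - u (n - 1)`, acting on
the vectors `(u n, u (n - 1))`. -/
def transferStep {R : Type*} [CommRing R] (a : R) : Matrix (Fin 2) (Fin 2) R :=
  !![a, -1; 1, 0]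

/-- The transfer matrix over `j` steps, starting at `n`, of the recursion
`u (n + 1) = a n * u n - u (n - 1)`. -/
def transferMatrix {R : Type*} [CommRing R] (a : ℤ → R) (n : ℤ) : ℕ → Matrix (Fin 2) (Fin 2) R
  | 0 => 1
  | j + 1 => transferStep (a (n + j)) * transferMatrix a n j

section Transfer

variable {R : Type*} [CommRing R]

theorem det_transferStep (a : R) : (transferStep a).det = 1 := by
  simp [transferStep, Matrix.det_fin_two]

theorem det_transferMatrix (a : ℤ → R) (n : ℤ) (j : ℕ) : (transferMatrix a n j).det = 1 := by
  induction j with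
  | zero => simp [transferMatrix]
  | succ j ih => simp [transferMatrix, ih, det_transferStep]

theorem map_transferMatrix {S : Type*} [CommRing S] (f : R →+* S) (a : ℤ → R) (n : ℤ) (j : ℕ) :
    (transferMatrix a n j).map f = transferMatrix (fun m => f (a m)) n j := by
  induction j with
  | zero => simp [transferMatrix, Matrix.map_one]
  | succ j ih =>
    rw [transferMatrix, transferMatrix, Matrix.map_mul, ih]
    congr 1
    ext i k
    fin_cases i <;> fin_cases k <;> simp [transferStep]

theorem transferMatrix_add (a : ℤ → R) (n : ℤ) (i j : ℕ) :
    transferMatrix a n (i + j) = transferMatrix a (n + i) j * transferMatrix a n i := by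
  induction j with
  | zero => simp [transferMatrix]
  | succ j ih =>
    rw [← add_assoc, transferMatrix, ih, transferMatrix, Matrix.mul_assoc]
    push_cast
    rw [add_assoc]

theorem transferMatrix_add_period {a : ℤ → R} {p : ℤ} (ha : ∀ n, a (n + p) = a n)
    (n : ℤ) (j : ℕ) : transferMatrix a (n + p) j = transferMatrix a n j := by
  induction j with
  | zero => rfl
  | succ j ih => rw [transferMatrix, transferMatrix, ih, add_right_comm, ha]

theorem trace_transferMatrix_add_one {a : ℤ → R} {p : ℕ} (ha : ∀ n, a (n + p) = a n) (n : ℤ) :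
    (transferMatrix a (n + 1) p).trace = (transferMatrix a n p).trace := by
  set B := transferStep (a n) with hB
  have h1 : transferMatrix a n 1 = B := by simp [transferMatrix, hB]
  have hcomm : transferMatrix a (n + 1) p * B = B * transferMatrix a n p := by
    have h2 := transferMatrix_add a n 1 p
    rw [add_comm 1 p, transferMatrix_add, transferMatrix_add_period ha, h1] at h2
    exact_mod_cast h2.symm
  have hadj : B * B.adjugate = 1 := by
    rw [Matrix.mul_adjugate, det_transferStep, one_smul]
  have hadj' : B.adjugate * B = 1 := by
    rw [Matrix.adjugate_mul, det_transferStep, one_smul]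
  calc (transferMatrix a (n + 1) p).trace
      = (transferMatrix a (n + 1) p * B * B.adjugate).trace := by
        rw [Matrix.mul_assoc, hadj, Matrix.mul_one]
    _ = (transferMatrix a n p).trace := by
        rw [hcomm, Matrix.trace_mul_comm, ← Matrix.mul_assoc, hadj', Matrix.one_mul]

/-- The trace of the monodromy matrix does not depend on the base point. -/
theorem trace_transferMatrix_period {a : ℤ → R} {p : ℕ} (ha : ∀ n, a (n + p) = a n) (n : ℤ) :
    (transferMatrix a n p).trace = (transferMatrix a 0 p).trace := by
  induction n using Int.induction_on with
  | zero => rfl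
  | succ i ih => rw [trace_transferMatrix_add_one ha, ih]
  | pred i ih => rw [← ih, ← trace_transferMatrix_add_one ha, sub_add_cancel]

end Transfer

/-- A real number `t` with `|t| ≤ 2` is the trace of a pair of conjugate unimodular numbers. -/
theorem exists_norm_eq_one_sq_add_one_eq {t : ℝ} (ht : |t| ≤ 2) :
    ∃ z : ℂ, ‖z‖ = 1 ∧ z ^ 2 + 1 = t * z := by
  have h4 : 0 ≤ 1 - (t / 2) ^ 2 := by nlinarith [abs_le.mp ht]
  have hs := Real.sq_sqrt h4
  set s := √(1 - (t / 2) ^ 2)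
  refine ⟨⟨t / 2, s⟩, ?_, ?_⟩
  · rw [← sq_eq_sq₀ (norm_nonneg _) zero_le_one, Complex.sq_norm, Complex.normSq_mk]
    linarith
  · apply Complex.ext
    · simp [pow_two]
      linarith
    · simp [pow_two]
      ring

/-- An eigenvector of the monodromy matrix to a nonzero eigenvalue extends to a Floquet
solution. -/
theorem exists_floquet_solution {a : ℤ → ℂ} {p : ℕ} (hp : 1 ≤ p) (ha : ∀ n, a (n + p) = a n)
    {z : ℂ} (hz : z ≠ 0) {w : Fin 2 → ℂ} (hw : w ≠ 0)
    (hTw : (transferMatrix a 0 p).mulVec w = z • w) :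
    ∃ u : ℤ → ℂ, (∃ n, u n ≠ 0) ∧ (∀ n, u (n + 1) + u (n - 1) = a n * u n) ∧
      ∀ n, u (n + p) = z * u n := by
  set F : ℕ → Fin 2 → ℂ := fun j => (transferMatrix a 0 j).mulVec w with hF
  have hFp (j : ℕ) : F (j + p) = z • F j := by
    simp only [hF]
    rw [add_comm j p, transferMatrix_add, transferMatrix_add_period ha, ← Matrix.mulVec_mulVec,
      hTw, Matrix.mulVec_smul]
  have hFpm (j m : ℕ) : F (j + p * m) = z ^ m • F j := by
    induction m with
    | zero => simp
    | succ m ih => rw [mul_add_one, ← add_assoc, hFp, ih, smul_smul, pow_succ']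
  have hF0 (j : ℕ) : F (j + 1) 0 = a j * F j 0 - F j 1 := by
    simp only [hF]
    rw [transferMatrix, ← Matrix.mulVec_mulVec]
    simp [transferStep, Matrix.mulVec, dotProduct, Fin.sum_univ_two, sub_eq_add_neg]
  have hF1 (j : ℕ) : F (j + 1) 1 = F j 0 := by
    simp only [hF]
    rw [transferMatrix, ← Matrix.mulVec_mulVec]
    simp [transferStep, Matrix.mulVec, dotProduct, Fin.sum_univ_two]
  have hapm (n : ℤ) (m : ℕ) : a (n + p * m) = a n := by
    induction m with
    | zero => simp
    | succ m ih => rw [Nat.cast_succ, mul_add_one, ← add_assoc, ha, ih]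
  have hle (n : ℤ) : 0 ≤ n + p * n.natAbs := by
    have h1 : (n.natAbs : ℤ) ≤ p * n.natAbs := by
      have : n.natAbs ≤ p * n.natAbs := Nat.le_mul_of_pos_left _ hp
      exact_mod_cast this
    omega
  set u : ℤ → ℂ := fun n => (z ^ n.natAbs)⁻¹ * F (n + p * n.natAbs).toNat 0 with hu
  have key (n : ℤ) (m j : ℕ) (h : n + p * m = j) : u n = (z ^ m)⁻¹ * F j 0 := by
    obtain ⟨i, hi⟩ := Int.eq_ofNat_of_zero_le (hle n)
    have hij : j + p * n.natAbs = i + p * m := by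
      zify at hi h ⊢
      linarith
    have h1 := congrFun (hFpm j n.natAbs) 0
    rw [hij, hFpm] at h1
    simp only [Pi.smul_apply, smul_eq_mul] at h1
    simp only [hu, hi, Int.toNat_natCast]
    field_simp
    linear_combination h1
  have heq (n : ℤ) : u (n + 1) + u (n - 1) = a n * u n := by
    have hpos : 0 ≤ n - 1 + p * (n.natAbs + 1 : ℕ) := by
      have := hle n
      push_cast at this ⊢
      have : (1 : ℤ) ≤ p := by exact_mod_cast hp
      linarith
    obtain ⟨i, hi⟩ := Int.eq_ofNat_of_zero_le hpos
    rw [key (n - 1) (n.natAbs + 1) i hi, key n (n.natAbs + 1) (i + 1) (by push_cast at *; linarith),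
      key (n + 1) (n.natAbs + 1) (i + 1 + 1) (by push_cast at *; linarith), hF0, hF1,
      ← hapm n (n.natAbs + 1), show n + p * (n.natAbs + 1 : ℕ) = (i + 1 : ℕ) by
        push_cast at *; linarith]
    ring
  refine ⟨u, ?_, heq, fun n => ?_⟩
  · by_contra! h0
    have hFz (j : ℕ) : F j 0 = 0 := by
      rw [← h0 j, key j 0 j (by simp)]
      simp
    apply hw
    have hw0 : F 0 = w := by simp only [hF, transferMatrix, Matrix.one_mulVec]
    have h1 := hF0 0
    rw [hFz, hFz, hw0] at h1
    have h2 := hFz 0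
    rw [hw0] at h2
    ext i
    fin_cases i
    · exact h2
    · simpa using h1.symm
  · have h2 := hle n
    obtain ⟨i, hi⟩ := Int.eq_ofNat_of_zero_le h2
    rw [key n _ i hi, key (n + p) n.natAbs (i + p) (by push_cast at *; linarith), hFp]
    simp
    ring

/-- A `2 × 2` matrix of determinant `1` whose trace is real and at most `2` in absolute value has a
unimodular eigenvalue. -/
theorem exists_norm_eq_one_eigenvector {T : Matrix (Fin 2) (Fin 2) ℂ} (hdet : T.det = 1)
    {t : ℝ} (htr : T.trace = t) (ht : |t| ≤ 2) :
    ∃ z : ℂ, ‖z‖ = 1 ∧ ∃ w : Fin 2 → ℂ, w ≠ 0 ∧ T.mulVec w = z • w := by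
  obtain ⟨z, hz, hzt⟩ := exists_norm_eq_one_sq_add_one_eq ht
  refine ⟨z, hz, ?_⟩
  have hd : (T - z • (1 : Matrix (Fin 2) (Fin 2) ℂ)).det = 0 := by
    rw [Matrix.det_fin_two] at hdet ⊢
    rw [Matrix.trace_fin_two] at htr
    simp
    linear_combination hdet + hzt - z * htr
  obtain ⟨w, hw, hTw⟩ := Matrix.exists_mulVec_eq_zero_iff.mpr hd
  refine ⟨w, hw, ?_⟩
  rw [Matrix.sub_mulVec, Matrix.smul_mulVec, Matrix.one_mulVec] at hTw
  exact sub_eq_zero.mp hTw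

section Operator

open Polynomial

variable {p : ℕ} {V : ℤ → ℝ} {H : lp (fun _ : ℤ => ℝ) 2 →L[ℝ] lp (fun _ : ℤ => ℝ) 2}

theorem apply_add_eq_transferMatrix
    (hH : ∀ ψ : lp (fun _ : ℤ => ℝ) 2, ∀ n : ℤ, H ψ n = ψ (n + 1) + ψ (n - 1) + V n * ψ n)
    (n : ℤ) (j : ℕ) (ψ : lp (fun _ : ℤ => ℝ) 2) :
    ψ (n + j) = aeval H (transferMatrix (fun m => X - C (V m)) n j 0 0) ψ n +
        aeval H (transferMatrix (fun m => X - C (V m)) n j 0 1) ψ (n - 1) ∧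
      ψ (n + j - 1) = aeval H (transferMatrix (fun m => X - C (V m)) n j 1 0) ψ n +
        aeval H (transferMatrix (fun m => X - C (V m)) n j 1 1) ψ (n - 1) := by
  induction j generalizing ψ with
  | zero => simp [transferMatrix]
  | succ j ih =>
    have h1 := (ih (H ψ)).1
    obtain ⟨h2, h3⟩ := ih ψ
    have hcomm (q : ℝ[X]) : aeval H q (H ψ) = H (aeval H q ψ) := by
      have := congrArg (fun A => A ψ)
        (show aeval H q * H = H * aeval H q by
          have := congrArg (aeval H) (mul_comm q X)
          rwa [map_mul, map_mul, aeval_X] at this)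
      exact this
    have h4 := hH ψ (n + j)
    have hsmul (χ : lp (fun _ : ℤ => ℝ) 2) (c : ℝ) (m : ℤ) : (c • χ) m = c * χ m := rfl
    constructor
    · simp [transferMatrix, transferStep, Matrix.mul_apply, Fin.sum_univ_two, sub_mul, hsmul,
        -lp.coeFn_smul, Algebra.algebraMap_eq_smul_one]
      rw [hcomm, hcomm] at h1
      rw [← add_assoc]
      linear_combination h1 - h4 - V (n + j) * h2 - h3
    · simp [transferMatrix, transferStep, Matrix.mul_apply, Fin.sum_univ_two, h2, ← add_assoc]

/-- The discriminant of a periodic Schrödinger operator, evaluated at the operator, is the sum of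
the translations by plus and minus one period. -/
theorem aeval_discriminant_apply (hV : ∀ n : ℤ, V (n + p) = V n)
    (hH : ∀ ψ : lp (fun _ : ℤ => ℝ) 2, ∀ n : ℤ, H ψ n = ψ (n + 1) + ψ (n - 1) + V n * ψ n)
    (ψ : lp (fun _ : ℤ => ℝ) 2) (n : ℤ) :
    aeval H (transferMatrix (fun m => X - C (V m)) 0 p).trace ψ n = ψ (n + p) + ψ (n - p) := by
  have ha (n : ℤ) : X - C (V (n + p)) = X - C (V n) := by rw [hV]
  set a : ℤ → ℝ[X] := fun m => X - C (V m)
  rw [← trace_transferMatrix_period ha n]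
  have hfwd := (apply_add_eq_transferMatrix hH n p ψ).1
  have hshift := transferMatrix_add_period (a := a) ha (n - p) p
  rw [sub_add_cancel] at hshift
  have hdet := det_transferMatrix a n p
  have h1 := (apply_add_eq_transferMatrix hH (n - p) p
    (aeval H (transferMatrix a n p 1 1) ψ)).1
  have h2 := (apply_add_eq_transferMatrix hH (n - p) p
    (aeval H (transferMatrix a n p 0 1) ψ)).2
  rw [← hshift, sub_add_cancel] at h1 h2
  set T := transferMatrix a n p
  simp only [← mul_apply_eq_comp, ← map_mul] at h1 h2
  rw [Matrix.det_fin_two] at hdet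
  have h3 : aeval H (T 0 0 * T 1 1) ψ (n - p) - aeval H (T 1 0 * T 0 1) ψ (n - p) = ψ (n - p) := by
    have := congrArg (fun q => aeval H q ψ (n - p)) hdet
    rw [mul_comm (T 1 0)]
    simpa only [map_sub, map_one, sub_apply, lp.coeFn_sub, Pi.sub_apply,
      one_apply_eq_self] using this
  rw [mul_comm (T 1 1)] at h2
  rw [Matrix.trace_fin_two, map_add, add_apply, lp.coeFn_add, Pi.add_apply]
  linear_combination h1 - h2 + h3 - hfwd

theorem lp_two_hasSum_sq (ψ : lp (fun _ : ℤ => ℝ) 2) :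
    HasSum (fun n => ψ n ^ 2) (‖ψ‖ ^ 2) := by
  have := lp.hasSum_norm (p := 2) (by norm_num) ψ
  simpa using this

theorem norm_le_two_mul_of_sq_le (p : ℤ) {φ ψ : lp (fun _ : ℤ => ℝ) 2}
    (h : ∀ n, φ n ^ 2 ≤ 2 * (ψ (n + p) ^ 2 + ψ (n - p) ^ 2)) : ‖φ‖ ≤ 2 * ‖ψ‖ := by
  have hshift {f : ℤ → ℝ} {c : ℝ} (hf : HasSum f c) :
      HasSum (fun n => 2 * (f (n + p) + f (n - p))) (2 * (c + c)) :=
    (((Equiv.addRight p).hasSum_iff.mpr hf).add ((Equiv.subRight p).hasSum_iff.mpr hf)).mul_left 2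
  have hψ := hshift (lp_two_hasSum_sq ψ)
  have hsum : ‖φ‖ ^ 2 ≤ 2 * (‖ψ‖ ^ 2 + ‖ψ‖ ^ 2) :=
    hasSum_le h (lp_two_hasSum_sq φ) hψ
  have h0 : 0 ≤ ‖ψ‖ := norm_nonneg ψ
  refine abs_le_of_sq_le_sq' ?_ (by linarith) |>.2
  linarith

theorem norm_aeval_discriminant_le (hV : ∀ n : ℤ, V (n + p) = V n)
    (hH : ∀ ψ : lp (fun _ : ℤ => ℝ) 2, ∀ n : ℤ, H ψ n = ψ (n + 1) + ψ (n - 1) + V n * ψ n) :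
    ‖aeval H (transferMatrix (fun m => X - C (V m)) 0 p).trace‖ ≤ 2 := by
  refine ContinuousLinearMap.opNorm_le_bound _ zero_le_two fun ψ => ?_
  have hle (n : ℤ) : (aeval H (transferMatrix (fun m => X - C (V m)) 0 p).trace ψ n) ^ 2 ≤
      2 * (ψ (n + p) ^ 2 + ψ (n - p) ^ 2) := by
    rw [aeval_discriminant_apply hV hH]
    nlinarith [sq_nonneg (ψ (n + p) - ψ (n - p))]
  exact norm_le_two_mul_of_sq_le p hle

/-- At a point of the spectrum the discriminant is at most `2` in absolute value. -/
theorem abs_eval_discriminant_le (hV : ∀ n : ℤ, V (n + p) = V n)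
    (hH : ∀ ψ : lp (fun _ : ℤ => ℝ) 2, ∀ n : ℤ, H ψ n = ψ (n + 1) + ψ (n - 1) + V n * ψ n)
    {E : ℝ} (hE : E ∈ spectrum ℝ H) :
    |(transferMatrix (fun m => X - C (V m)) 0 p).trace.eval E| ≤ 2 := by
  set Δ := (transferMatrix (fun m => X - C (V m)) 0 p).trace with hΔ
  have h1 : Δ.eval E ∈ spectrum ℝ (aeval H Δ) :=
    spectrum.subset_polynomial_aeval H Δ ⟨E, hE, rfl⟩
  have h2 := spectrum.norm_le_norm_mul_of_mem h1
  have h3 : ‖(1 : lp (fun _ : ℤ => ℝ) 2 →L[ℝ] lp (fun _ : ℤ => ℝ) 2)‖ ≤ 1 :=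
    ContinuousLinearMap.norm_id_le
  have h4 : ‖aeval H Δ‖ ≤ 2 := norm_aeval_discriminant_le hV hH
  rw [Real.norm_eq_abs] at h2
  nlinarith [norm_nonneg (aeval H Δ)]

/-- Outside the spectrum every bounded real solution is square summable. -/
theorem summable_sq_of_notMem_spectrum
    (hH : ∀ ψ : lp (fun _ : ℤ => ℝ) 2, ∀ n : ℤ, H ψ n = ψ (n + 1) + ψ (n - 1) + V n * ψ n)
    {E : ℝ} (hE : E ∉ spectrum ℝ H) {v : ℤ → ℝ} {K : ℝ} (hK : ∀ n, |v n| ≤ K)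
    (hv : ∀ n, v (n + 1) + v (n - 1) + V n * v n = E * v n) :
    Summable fun n => v n ^ 2 := by
  rw [spectrum.notMem_iff] at hE
  obtain ⟨A, hA⟩ := hE.exists_left_inv
  have hbound (ψ : lp (fun _ : ℤ => ℝ) 2) : ‖ψ‖ ≤ ‖A‖ * ‖E • ψ - H ψ‖ := by
    have : A (E • ψ - H ψ) = ψ := by
      have := congrArg (fun B => B ψ) hA
      simpa [Algebra.algebraMap_eq_smul_one] using this
    conv_lhs => rw [← this]
    exact A.le_opNorm _
  have hK0 : 0 ≤ K := (abs_nonneg _).trans (hK 0)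
  have hfin (N : ℕ) : ∑ n ∈ Finset.Icc (-N : ℤ) N, v n ^ 2 ≤ ‖A‖ ^ 2 * (4 * (2 * K) ^ 2) := by
    have hmem : Memℓp (fun n => if n ∈ Finset.Icc (-N : ℤ) N then v n else 0) 2 := by
      refine memℓp_gen (summable_of_ne_finset_zero (s := Finset.Icc (-N : ℤ) N) fun n hn => ?_)
      simp [hn]
    set ψ : lp (fun _ : ℤ => ℝ) 2 := ⟨_, hmem⟩
    have hψ (n : ℤ) : ψ n = if n ∈ Finset.Icc (-N : ℤ) N then v n else 0 := rfl
    have hψN : ‖ψ‖ ^ 2 = ∑ n ∈ Finset.Icc (-N : ℤ) N, v n ^ 2 := by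
      refine (lp_two_hasSum_sq ψ).unique ?_
      have : HasSum (fun n => ψ n ^ 2) (∑ n ∈ Finset.Icc (-N : ℤ) N, ψ n ^ 2) :=
        hasSum_sum_of_ne_finset_zero fun n hn => by simp only [hψ, if_neg hn]; norm_num
      rwa [Finset.sum_congr rfl fun n hn => by rw [hψ, if_pos hn]] at this
    have hφ (n : ℤ) : (E • ψ - H ψ) n = E * ψ n - (ψ (n + 1) + ψ (n - 1) + V n * ψ n) := by
      rw [← hH]
      rfl
    set s : Finset ℤ := {(-N - 1 : ℤ), (-N : ℤ), (N : ℤ), (N + 1 : ℤ)} with hs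
    have hφ0 (n : ℤ) (hn : n ∉ s) : (E • ψ - H ψ) n = 0 := by
      simp only [hs, Finset.mem_insert, Finset.mem_singleton, not_or] at hn
      rw [hφ, hψ, hψ, hψ]
      simp only [Finset.mem_Icc]
      by_cases h : -N ≤ n ∧ n ≤ N
      · rw [if_pos h, if_pos (by omega), if_pos (by omega)]
        linarith [hv n]
      · rw [if_neg h, if_neg (by omega), if_neg (by omega)]
        ring
    have hφK (n : ℤ) : |(E • ψ - H ψ) n| ≤ 2 * K := by
      have h1 := abs_le.mp (hK (n + 1))
      have h2 := abs_le.mp (hK (n - 1))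
      have h3 := hv n
      rw [hφ, hψ, hψ, hψ, abs_le]
      split_ifs <;> constructor <;> linarith
    have hφN : ‖E • ψ - H ψ‖ ^ 2 ≤ 4 * (2 * K) ^ 2 := by
      have h1 : ‖E • ψ - H ψ‖ ^ 2 = ∑ n ∈ s, (E • ψ - H ψ) n ^ 2 :=
        (lp_two_hasSum_sq (E • ψ - H ψ)).unique
          (hasSum_sum_of_ne_finset_zero fun n hn => by rw [hφ0 n hn]; norm_num)
      have hcard : (s.card : ℝ) ≤ 4 := by
        have : s.card ≤ 4 := Finset.card_le_four
        exact_mod_cast this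
      rw [h1]
      calc _ ≤ s.card • (2 * K) ^ 2 :=
            Finset.sum_le_card_nsmul _ _ _ fun n _ => sq_le_sq' (abs_le.mp (hφK n)).1
              (abs_le.mp (hφK n)).2
        _ ≤ _ := by
            rw [nsmul_eq_mul]
            gcongr
    rw [← hψN]
    calc ‖ψ‖ ^ 2 ≤ (‖A‖ * ‖E • ψ - H ψ‖) ^ 2 := by gcongr; exact hbound ψ
      _ ≤ _ := by rw [mul_pow]; gcongr
  refine summable_of_sum_le (c := ‖A‖ ^ 2 * (4 * (2 * K) ^ 2)) (fun n => sq_nonneg (v n))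
    fun t => ?_
  refine (Finset.sum_le_sum_of_subset_of_nonneg (fun n hn => ?_) fun _ _ _ => sq_nonneg _).trans
    (hfin (t.sup Int.natAbs))
  have := Finset.le_sup (f := Int.natAbs) hn
  rw [Finset.mem_Icc]
  omega

/-- A function on `ℤ` that is periodic in norm is bounded. -/
theorem norm_le_of_norm_periodic {u : ℤ → ℂ} (hp : 1 ≤ p) (hu : ∀ n, ‖u (n + p)‖ = ‖u n‖)
    (n : ℤ) : ‖u n‖ ≤ ∑ i ∈ Finset.Ico (0 : ℤ) p, ‖u i‖ := by
  have hper : Function.Periodic (fun n => ‖u n‖) (p : ℤ) := hu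
  have h1 : ‖u n‖ = ‖u (n % p)‖ := by
    conv_lhs => rw [← Int.emod_add_mul_ediv n p, mul_comm]
    exact hper.int_mul (n / p) (n % p)
  have hp0 : (0 : ℤ) < p := by exact_mod_cast hp
  rw [h1]
  exact Finset.single_le_sum (f := fun i => ‖u i‖) (fun _ _ => norm_nonneg _)
    (Finset.mem_Ico.mpr ⟨Int.emod_nonneg _ hp0.ne', Int.emod_lt_of_pos _ hp0⟩)

/-- A square summable function on `ℤ` that is periodic in norm vanishes. -/
theorem eq_zero_of_norm_periodic_of_summable {u : ℤ → ℂ} (hp : 1 ≤ p)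
    (hu : ∀ n, ‖u (n + p)‖ = ‖u n‖) (hs : Summable fun n => ‖u n‖ ^ 2) (n : ℤ) : u n = 0 := by
  have hinj : Function.Injective fun j : ℕ => n + j * (p : ℤ) := fun i j hij => by
    have hp0 : p ≠ 0 := by omega
    simpa [hp0] using hij
  have hper : Function.Periodic (fun n => ‖u n‖ ^ 2) (p : ℤ) := fun n => by simp [hu]
  have h1 := hs.tendsto_cofinite_zero.comp hinj.tendsto_cofinite
  have h2 : (fun n => ‖u n‖ ^ 2) ∘ (fun j : ℕ => n + j * (p : ℤ)) = fun _ => ‖u n‖ ^ 2 := by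
    funext j
    exact hper.nat_mul j n
  rw [h2, tendsto_const_nhds_iff] at h1
  simpa using h1

end Operator


/-- For a `p`-periodic potential `V : ℤ → ℝ` (`p ≥ 1`) and the
Schrödinger operator `H` on `ℓ²(ℤ)` with potential `V`, one has `E ∈ σ(H)` if
and only if there exist `k ∈ ℝ` and a not identically vanishing `u : ℤ → ℂ`
with `u(n+1) + u(n-1) + V(n)u(n) = E u(n)` and `u(n+p) = e^{ikp} u(n)` for all
`n`. -/
theorem statement13
    (p : ℕ) (hp : 1 ≤ p) (V : ℤ → ℝ) (hV : ∀ n : ℤ, V (n + p) = V n)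
    (H : lp (fun _ : ℤ => ℝ) 2 →L[ℝ] lp (fun _ : ℤ => ℝ) 2)
    (hH : ∀ ψ : lp (fun _ : ℤ => ℝ) 2, ∀ n : ℤ,
        H ψ n = ψ (n + 1) + ψ (n - 1) + V n * ψ n)
    (E : ℝ) :
    E ∈ spectrum ℝ H ↔
      ∃ (k : ℝ) (u : ℤ → ℂ), (∃ n : ℤ, u n ≠ 0) ∧
        (∀ n : ℤ, u (n + 1) + u (n - 1) + (V n : ℂ) * u n = (E : ℂ) * u n) ∧
        (∀ n : ℤ, u (n + p) = Complex.exp (Complex.I * k * p) * u n) := by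
  constructor
  · intro hE
    have ht := abs_eval_discriminant_le hV hH hE
    set a : ℤ → Polynomial ℝ := fun m => Polynomial.X - Polynomial.C (V m)
    set f : Polynomial ℝ →+* ℂ := Complex.ofRealHom.comp (Polynomial.evalRingHom E)
    have hfa (n : ℤ) : f (a n) = E - V n := by simp [f, a]
    have hdet := det_transferMatrix (fun m => f (a m)) 0 p
    have htr : (transferMatrix (fun m => f (a m)) 0 p).trace =
        ((transferMatrix a 0 p).trace.eval E : ℝ) := by
      rw [← map_transferMatrix, Matrix.trace_fin_two, Matrix.trace_fin_two]
      simp [f]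
    obtain ⟨z, hz, w, hw, hTw⟩ := exists_norm_eq_one_eigenvector hdet htr ht
    obtain ⟨u, hu0, hu, hup⟩ := exists_floquet_solution hp
      (fun n => by simp only [hfa, hV]) (norm_ne_zero_iff.mp (by rw [hz]; exact one_ne_zero)) hw hTw
    have hp0 : (p : ℂ) ≠ 0 := by exact_mod_cast (by omega : p ≠ 0)
    refine ⟨z.arg / p, u, hu0, fun n => ?_, fun n => ?_⟩
    · linear_combination hu n + u n * hfa n
    · have hexp : Complex.exp (Complex.I * (z.arg / p : ℝ) * p) = z := by
        have := Complex.norm_mul_exp_arg_mul_I z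
        rw [hz, Complex.ofReal_one, one_mul] at this
        conv_rhs => rw [← this]
        congr 1
        push_cast
        field_simp
      rw [hexp, hup]
  · rintro ⟨k, u, ⟨n₀, hn₀⟩, hu, hup⟩
    by_contra hE
    have hnorm (n : ℤ) : ‖u (n + p)‖ = ‖u n‖ := by
      have : Complex.I * k * p = ((k * p : ℝ) : ℂ) * Complex.I := by push_cast; ring
      rw [hup, norm_mul, this, Complex.norm_exp_ofReal_mul_I, one_mul]
    have hbound := norm_le_of_norm_periodic hp hnorm
    have hre := summable_sq_of_notMem_spectrum hH hE
      (fun n => (Complex.abs_re_le_norm _).trans (hbound n))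
      (fun n => by simpa using congrArg Complex.re (hu n))
    have him := summable_sq_of_notMem_spectrum hH hE
      (fun n => (Complex.abs_im_le_norm _).trans (hbound n))
      (fun n => by simpa using congrArg Complex.im (hu n))
    refine hn₀ (eq_zero_of_norm_periodic_of_summable hp hnorm ((hre.add him).congr fun n => ?_) n₀)
    rw [Complex.sq_norm, Complex.normSq_apply]
    ring
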